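/- The closure of ⋃_N 𝒞_N in the supremum norm, taken inside the space of bounded functions on ℝ² that are 2π-periodic in each variable, is exactly the algebra 𝒜. (This identifies the C*-algebra C(Y_∞) for the torus with the group ℤ acting by vertical shifts (x₁,x₂) ↦ (x₁, x₂ + k).) -/

import Mathlib

open Filter Topology

noncomputable section

/-- The set `E ⊂ ℝ` of reals congruent to an integer modulo `2π`. -/
def ESet : Set ℝ := {x | ∃ k m : ℤ, x = (k : ℝ) + 2 * Real.pi * (m : ℝ)}

/-- The set `E_N ⊂ ℝ` of reals congruent to an integer `k` with `|k| ≤ N` modulo `2π`. -/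
def ESetN (N : ℕ) : Set ℝ :=
  {x | ∃ k m : ℤ, |k| ≤ (N : ℤ) ∧ x = (k : ℝ) + 2 * Real.pi * (m : ℝ)}

/-- The function `f : ℝ² → ℂ` is bounded. -/
def Bdd (f : ℝ × ℝ → ℂ) : Prop := ∃ C : ℝ, ∀ p, ‖f p‖ ≤ C

/-- The function `f : ℝ² → ℂ` is `2π`-periodic in each variable. -/
def Per (f : ℝ × ℝ → ℂ) : Prop :=
  ∀ x y : ℝ, f (x + 2 * Real.pi, y) = f (x, y) ∧ f (x, y + 2 * Real.pi) = f (x, y)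

/-- A bounded continuous `2π`-periodic function of one variable. -/
def NicePer (g : ℝ → ℂ) : Prop :=
  (∃ C : ℝ, ∀ x, ‖g x‖ ≤ C) ∧ Continuous g ∧ ∀ x, g (x + 2 * Real.pi) = g x

/-- `gp` and `gm` are the one-sided limits of `f` from above and from below along the
horizontal line at height `e`, and `f` is right-continuous there:
`f(y₁,t) → gp(x₁)` as `(y₁,t) → (x₁,e)`, `t > e`; `f(y₁,t) → gm(x₁)` as `(y₁,t) → (x₁,e)`,
`t < e`; and `f(x₁,e) = gp(x₁)`. -/
def SidedLimits (f : ℝ × ℝ → ℂ) (e : ℝ) (gp gm : ℝ → ℂ) : Prop :=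
  NicePer gp ∧ NicePer gm ∧
  ∀ x₁ : ℝ,
    Tendsto f (𝓝[{p : ℝ × ℝ | e < p.2}] (x₁, e)) (𝓝 (gp x₁)) ∧
    Tendsto f (𝓝[{p : ℝ × ℝ | p.2 < e}] (x₁, e)) (𝓝 (gm x₁)) ∧
    f (x₁, e) = gp x₁

/-- Membership in the algebra `𝒜`: `f` is bounded, `2π`-periodic in each variable,
continuous at every point `(x₁,x₂)` with `x₂ ∉ E`, has one-sided limit functions
`f_e⁺ = gp e`, `f_e⁻ = gm e` (with right continuity) at every `e ∈ E`, and
`sup_{x₁} |f_k⁺(x₁) − f_k⁻(x₁)| → 0` as `|k| → ∞`, `k ∈ ℤ`. -/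
def MemA (f : ℝ × ℝ → ℂ) : Prop :=
  Bdd f ∧ Per f ∧
  (∀ p : ℝ × ℝ, p.2 ∉ ESet → ContinuousAt f p) ∧
  ∃ gp gm : ℝ → ℝ → ℂ,
    (∀ e ∈ ESet, SidedLimits f e (gp e) (gm e)) ∧
    Tendsto (fun k : ℤ => ⨆ x : ℝ, ‖gp (k : ℝ) x - gm (k : ℝ) x‖) cofinite (𝓝 0)

/-- Membership in `𝒞_N`: `f` is bounded, `2π`-periodic in each variable, continuous at
every point `(x₁,x₂)` with `x₂ ∉ E_N`, and has one-sided limit functions (with right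
continuity) at every `e ∈ E_N`. -/
def MemC (N : ℕ) (f : ℝ × ℝ → ℂ) : Prop :=
  Bdd f ∧ Per f ∧
  (∀ p : ℝ × ℝ, p.2 ∉ ESetN N → ContinuousAt f p) ∧
  ∀ e ∈ ESetN N, ∃ gp gm : ℝ → ℂ, SidedLimits f e gp gm

/-- `G` records the limits from below of `f` along every horizontal line, for a bounded
periodic function `f` that is continuous from above along every such line. -/
def HasLowerLimits (f G : ℝ × ℝ → ℂ) : Prop :=
  Bdd f ∧ Per f ∧ ∀ e, SidedLimits f e (fun x => f (x, e)) (fun x => G (x, e))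

instance neBot_nhdsWithin_below (x e : ℝ) : (𝓝[{p : ℝ × ℝ | p.2 < e}] (x, e)).NeBot := by
  have h : {p : ℝ × ℝ | p.2 < e} = Set.univ ×ˢ Set.Iio e := by ext; simp
  rw [h, nhdsWithin_prod_eq, nhdsWithin_univ]
  infer_instance

theorem tendsto_snd_below (x e : ℝ) :
    Tendsto Prod.snd (𝓝[{p : ℝ × ℝ | p.2 < e}] (x, e)) (𝓝[<] e) :=
  tendsto_nhdsWithin_iff.2 ⟨(continuous_snd.tendsto' (x, e) e rfl).mono_left nhdsWithin_le_nhds,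
    self_mem_nhdsWithin⟩

theorem tendsto_snd_above (x e : ℝ) :
    Tendsto Prod.snd (𝓝[{p : ℝ × ℝ | e < p.2}] (x, e)) (𝓝[≥] e) :=
  tendsto_nhdsWithin_iff.2 ⟨(continuous_snd.tendsto' (x, e) e rfl).mono_left nhdsWithin_le_nhds,
    mem_of_superset self_mem_nhdsWithin fun _ h => (Set.mem_Ioi.1 h).le⟩

theorem norm_sub_le_of_forall_pos {a b : ℂ} (h : ∀ ε : ℝ, 0 < ε → ‖a - b‖ ≤ 2 * ε) : a = b := by
  rw [← sub_eq_zero, ← norm_le_zero_iff]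
  refine le_of_forall_pos_le_add fun ε hε => ?_
  linarith [h (ε / 2) (by positivity)]

namespace NicePer

variable {a b : ℝ → ℂ}

theorem add (ha : NicePer a) (hb : NicePer b) : NicePer (fun x => a x + b x) := by
  obtain ⟨⟨C, hC⟩, hac, hap⟩ := ha
  obtain ⟨⟨D, hD⟩, hbc, hbp⟩ := hb
  exact ⟨⟨C + D, fun x => (norm_add_le _ _).trans (add_le_add (hC x) (hD x))⟩, hac.add hbc,
    fun x => by simp only [hap, hbp]⟩

theorem mul_const (ha : NicePer a) (c : ℂ) : NicePer (fun x => a x * c) := by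
  obtain ⟨⟨C, hC⟩, hac, hap⟩ := ha
  refine ⟨⟨C * ‖c‖, fun x => ?_⟩, hac.mul continuous_const, fun x => by simp only [hap]⟩
  rw [norm_mul]
  exact mul_le_mul_of_nonneg_right (hC x) (norm_nonneg _)

theorem sub (ha : NicePer a) (hb : NicePer b) : NicePer (fun x => a x - b x) := by
  have h := ha.add (hb.mul_const (-1))
  simpa [sub_eq_add_neg] using h

end NicePer

namespace SidedLimits

variable {f g : ℝ × ℝ → ℂ} {e : ℝ} {fp fm gp gm : ℝ → ℂ}

theorem add (hf : SidedLimits f e fp fm) (hg : SidedLimits g e gp gm) :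
    SidedLimits (fun p => f p + g p) e (fun x => fp x + gp x) (fun x => fm x + gm x) :=
  ⟨hf.1.add hg.1, hf.2.1.add hg.2.1, fun x => ⟨(hf.2.2 x).1.add (hg.2.2 x).1,
    (hf.2.2 x).2.1.add (hg.2.2 x).2.1, by simp only [(hf.2.2 x).2.2, (hg.2.2 x).2.2]⟩⟩

theorem mul_const (hf : SidedLimits f e fp fm) (c : ℂ) :
    SidedLimits (fun p => f p * c) e (fun x => fp x * c) (fun x => fm x * c) :=
  ⟨hf.1.mul_const c, hf.2.1.mul_const c, fun x => ⟨(hf.2.2 x).1.mul_const c,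
    (hf.2.2 x).2.1.mul_const c, by simp only [(hf.2.2 x).2.2]⟩⟩

theorem upper_eq (hf : SidedLimits f e fp fm) : fp = fun x => f (x, e) :=
  funext fun x => (hf.2.2 x).2.2.symm

theorem of_continuousAt (hb : Bdd f) (hp : Per f) (hc : ∀ x, ContinuousAt f (x, e)) :
    SidedLimits f e (fun x => f (x, e)) (fun x => f (x, e)) := by
  have hn : NicePer (fun x => f (x, e)) := by
    refine ⟨hb.imp fun C hC x => hC _, ?_, fun x => (hp x e).1⟩
    refine continuous_iff_continuousAt.2 fun x => ?_
    exact (hc x).comp (f := fun x : ℝ => (x, e)) (by fun_prop)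
  exact ⟨hn, hn, fun x => ⟨(hc x).mono_left nhdsWithin_le_nhds,
    (hc x).mono_left nhdsWithin_le_nhds, rfl⟩⟩

theorem eventually_norm_sub_lt (hf : SidedLimits f e fp fm) {x ε : ℝ}
    (h : ‖fp x - fm x‖ < ε) : ∀ᶠ q in 𝓝 (x, e), ‖fp x - f q‖ < ε := by
  obtain ⟨⟨-, hpc, -⟩, -, hl⟩ := hf
  have hε : 0 < ε := (norm_nonneg _).trans_lt h
  have habove := (tendsto_const_nhds (x := fp x)).sub (hl x).1 |>.norm.eventually_lt_const
    (u := ε) (by simpa using hε)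
  have hbelow := (tendsto_const_nhds (x := fp x)).sub (hl x).2.1 |>.norm.eventually_lt_const h
  have hon : ∀ᶠ q : ℝ × ℝ in 𝓝 (x, e), ‖fp x - fp q.1‖ < ε := by
    have hc : Continuous fun q : ℝ × ℝ => ‖fp x - fp q.1‖ := by fun_prop
    exact (hc.tendsto (x, e)).eventually_lt_const (by simpa using hε)
  filter_upwards [eventually_nhdsWithin_iff.1 habove, eventually_nhdsWithin_iff.1 hbelow, hon]
    with q h1 h2 h3
  rcases lt_trichotomy q.2 e with hq | hq | hq
  · exact h2 hq
  · have : q = (q.1, e) := by rw [← hq]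
    rw [this, (hl q.1).2.2]
    exact h3
  · exact h1 hq

theorem continuousAt (hf : SidedLimits f e fp fm) {x : ℝ} (h : fp x = fm x) :
    ContinuousAt f (x, e) := by
  rw [ContinuousAt, Metric.tendsto_nhds]
  intro ε hε
  filter_upwards [hf.eventually_norm_sub_lt (x := x) (ε := ε) (by simpa [h] using hε)] with q hq
  rwa [dist_comm, dist_eq_norm, (hf.2.2 x).2.2]

theorem lower_norm_sub_le (hf : SidedLimits f e fp fm) (hg : SidedLimits g e gp gm) {ε : ℝ}
    (h : ∀ p, ‖f p - g p‖ ≤ ε) (x : ℝ) : ‖fm x - gm x‖ ≤ ε :=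
  le_of_tendsto ((hf.2.2 x).2.1.sub (hg.2.2 x).2.1).norm (Eventually.of_forall h)

theorem norm_jump_le (hf : SidedLimits f e fp fm) (hg : SidedLimits g e gp gp) {ε : ℝ}
    (h : ∀ p, ‖f p - g p‖ ≤ ε) (x : ℝ) : ‖fp x - fm x‖ ≤ 2 * ε := by
  have h1 := hf.lower_norm_sub_le hg h x
  have h2 := h (x, e)
  rw [(hf.2.2 x).2.2, (hg.2.2 x).2.2] at h2
  calc ‖fp x - fm x‖ = ‖(fp x - gp x) - (fm x - gp x)‖ := by congr 1; ring
    _ ≤ 2 * ε := by linarith [norm_sub_le (fp x - gp x) (fm x - gp x)]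

theorem tendsto_of_approx {l : Filter (ℝ × ℝ)} {c : ℂ}
    (h : ∀ ε : ℝ, 0 < ε → ∃ (g : ℝ × ℝ → ℂ) (d : ℂ), Tendsto g l (𝓝 d) ∧
      (∀ p, ‖f p - g p‖ ≤ ε) ∧ ‖c - d‖ ≤ ε) : Tendsto f l (𝓝 c) := by
  rw [Metric.tendsto_nhds]
  intro ε hε
  obtain ⟨g, d, hg, hfg, hcd⟩ := h (ε / 4) (by positivity)
  filter_upwards [Metric.tendsto_nhds.1 hg (ε / 4) (by positivity)] with p hp
  rw [← dist_eq_norm] at hcd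
  have h1 := hfg p
  rw [← dist_eq_norm] at h1
  rw [dist_comm] at hcd
  linarith [dist_triangle4 (f p) (g p) d c]

theorem exists_tendsto_of_approx {l : Filter (ℝ × ℝ)} [l.NeBot]
    (h : ∀ ε : ℝ, 0 < ε → ∃ (g : ℝ × ℝ → ℂ) (d : ℂ), Tendsto g l (𝓝 d) ∧
      (∀ p, ‖f p - g p‖ ≤ ε)) : ∃ c, Tendsto f l (𝓝 c) := by
  refine CompleteSpace.complete (f := map f l) (Metric.cauchy_iff.2 ⟨inferInstance, ?_⟩)
  intro ε hε
  obtain ⟨g, d, hg, hfg⟩ := h (ε / 4) (by positivity)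
  refine ⟨f '' {p | dist (g p) d < ε / 4},
    image_mem_map (Metric.tendsto_nhds.1 hg (ε / 4) (by positivity)), ?_⟩
  rintro _ ⟨p, hp, rfl⟩ _ ⟨q, hq, rfl⟩
  have h1 := hfg p
  have h2 := hfg q
  rw [← dist_eq_norm] at h1 h2
  rw [Set.mem_ofPred_eq] at hp hq
  rw [dist_comm] at h2 hq
  linarith [dist_triangle4 (f p) (g p) d (f q), dist_triangle d (g q) (f q)]

theorem nicePer_of_approx {a : ℝ → ℂ}
    (h : ∀ ε : ℝ, 0 < ε → ∃ b, NicePer b ∧ ∀ x, ‖a x - b x‖ ≤ ε) : NicePer a := by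
  refine ⟨?_, ?_, fun x => norm_sub_le_of_forall_pos fun ε hε => ?_⟩
  · obtain ⟨b, ⟨⟨C, hC⟩, -⟩, hab⟩ := h 1 one_pos
    exact ⟨1 + C, fun x => by linarith [norm_sub_norm_le (a x) (b x), hC x, hab x]⟩
  · refine continuous_of_uniform_approx_of_continuous fun u hu => ?_
    obtain ⟨ε, hε, hu⟩ := Metric.mem_uniformity_dist.1 hu
    obtain ⟨b, hb, hab⟩ := h (ε / 2) (by positivity)
    refine ⟨b, hb.2.1, fun x => hu ?_⟩
    rw [dist_eq_norm]
    linarith [hab x]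
  · obtain ⟨b, hb, hab⟩ := h ε hε
    have h1 := hab (x + 2 * Real.pi)
    rw [hb.2.2] at h1
    calc ‖a (x + 2 * Real.pi) - a x‖ = ‖(a (x + 2 * Real.pi) - b x) - (a x - b x)‖ := by
          congr 1; ring
      _ ≤ 2 * ε := by linarith [norm_sub_le (a (x + 2 * Real.pi) - b x) (a x - b x), hab x]

theorem exists_of_approx
    (h : ∀ ε : ℝ, 0 < ε → ∃ (g : ℝ × ℝ → ℂ) (gp gm : ℝ → ℂ), SidedLimits g e gp gm ∧
      ∀ p, ‖f p - g p‖ ≤ ε) : ∃ fm, SidedLimits f e (fun x => f (x, e)) fm := by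
  have hex : ∀ x, ∃ c, Tendsto f (𝓝[{p : ℝ × ℝ | p.2 < e}] (x, e)) (𝓝 c) := fun x =>
    exists_tendsto_of_approx fun ε hε => by
      obtain ⟨g, gp, gm, hg, hfg⟩ := h ε hε
      exact ⟨g, gm x, (hg.2.2 x).2.1, hfg⟩
  choose fm hfm using hex
  refine ⟨fm, nicePer_of_approx fun ε hε => ?_, nicePer_of_approx fun ε hε => ?_,
    fun x => ⟨tendsto_of_approx fun ε hε => ?_, hfm x, rfl⟩⟩ <;>
  obtain ⟨g, gp, gm, hg, hfg⟩ := h ε hε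
  · exact ⟨gp, hg.1, fun x => by rw [← (hg.2.2 x).2.2]; exact hfg _⟩
  · exact ⟨gm, hg.2.1, fun x => le_of_tendsto ((hfm x).sub (hg.2.2 x).2.1).norm
      (Eventually.of_forall hfg)⟩
  · exact ⟨g, gp x, (hg.2.2 x).1, hfg, by rw [← (hg.2.2 x).2.2]; exact hfg _⟩

end SidedLimits

namespace HasLowerLimits

variable {f g F G : ℝ × ℝ → ℂ}

theorem add (hf : HasLowerLimits f F) (hg : HasLowerLimits g G) :
    HasLowerLimits (fun p => f p + g p) (fun p => F p + G p) := by
  obtain ⟨⟨C, hC⟩, hfp, hfl⟩ := hf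
  obtain ⟨⟨D, hD⟩, hgp, hgl⟩ := hg
  refine ⟨⟨C + D, fun p => (norm_add_le _ _).trans (add_le_add (hC p) (hD p))⟩, fun x y => ?_,
    fun e => (hfl e).add (hgl e)⟩
  simp only [(hfp x y).1, (hgp x y).1, (hfp x y).2, (hgp x y).2, and_self]

theorem mul_const (hf : HasLowerLimits f F) (c : ℂ) :
    HasLowerLimits (fun p => f p * c) (fun p => F p * c) := by
  obtain ⟨⟨C, hC⟩, hfp, hfl⟩ := hf
  refine ⟨⟨C * ‖c‖, fun p => ?_⟩, fun x y => ?_, fun e => (hfl e).mul_const c⟩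
  · rw [norm_mul]
    exact mul_le_mul_of_nonneg_right (hC p) (norm_nonneg _)
  · simp only [(hfp x y).1, (hfp x y).2, and_self]

theorem sub (hf : HasLowerLimits f F) (hg : HasLowerLimits g G) :
    HasLowerLimits (fun p => f p - g p) (fun p => F p - G p) := by
  have h := hf.add (hg.mul_const (-1))
  simpa [sub_eq_add_neg] using h

theorem of_continuous (hb : Bdd f) (hp : Per f) (hc : Continuous f) : HasLowerLimits f f :=
  ⟨hb, hp, fun _ => .of_continuousAt hb hp fun _ => hc.continuousAt⟩

theorem sum {ι : Type*} (s : Finset ι) {f F : ι → ℝ × ℝ → ℂ}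
    (h : ∀ i ∈ s, HasLowerLimits (f i) (F i)) :
    HasLowerLimits (fun p => ∑ i ∈ s, f i p) (fun p => ∑ i ∈ s, F i p) := by
  classical
  induction s using Finset.induction_on with
  | empty =>
    simpa using of_continuous (f := fun _ => 0) ⟨0, by simp⟩ (fun _ _ => ⟨rfl, rfl⟩)
      continuous_const
  | insert i s hi ih =>
    simp only [Finset.sum_insert hi]
    exact (h i (Finset.mem_insert_self i s)).add
      (ih fun j hj => h j (Finset.mem_insert_of_mem hj))

end HasLowerLimits

theorem memC_iff {N : ℕ} {f : ℝ × ℝ → ℂ} :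
    MemC N f ↔ ∃ G, HasLowerLimits f G ∧ ∀ p : ℝ × ℝ, p.2 ∉ ESetN N → f p = G p := by
  constructor
  · rintro ⟨hb, hp, hc, hl⟩
    have hex : ∀ e, ∃ gm : ℝ → ℂ, SidedLimits f e (fun x => f (x, e)) gm ∧
        (e ∉ ESetN N → ∀ x, f (x, e) = gm x) := by
      intro e
      by_cases he : e ∈ ESetN N
      · obtain ⟨gp, gm, h⟩ := hl e he
        exact ⟨gm, h.upper_eq ▸ h, fun h' => absurd he h'⟩
      · exact ⟨_, .of_continuousAt hb hp fun x => hc (x, e) he, fun _ _ => rfl⟩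
    choose gm h1 h2 using hex
    exact ⟨fun p => gm p.2 p.1, ⟨hb, hp, h1⟩, fun p hp => h2 p.2 hp p.1⟩
  · rintro ⟨G, ⟨hb, hp, hl⟩, hG⟩
    exact ⟨hb, hp, fun p hp => (hl p.2).continuousAt (hG p hp), fun e _ => ⟨_, _, hl e⟩⟩

theorem intCast_mem_ESet (k : ℤ) : (k : ℝ) ∈ ESet := ⟨k, 0, by simp⟩

theorem memA_iff {f : ℝ × ℝ → ℂ} :
    MemA f ↔ ∃ G, HasLowerLimits f G ∧ (∀ p : ℝ × ℝ, p.2 ∉ ESet → f p = G p) ∧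
      Tendsto (fun k : ℤ => ⨆ x : ℝ, ‖f (x, k) - G (x, k)‖) cofinite (𝓝 0) := by
  constructor
  · rintro ⟨hb, hp, hc, gp, gm, hl, ht⟩
    classical
    refine ⟨fun p => if p.2 ∈ ESet then gm p.2 p.1 else f p, ⟨hb, hp, fun e => ?_⟩,
      fun p hp => by simp only [if_neg hp], ?_⟩
    · by_cases he : e ∈ ESet
      · simp only [if_pos he]
        exact (hl e he).upper_eq ▸ hl e he
      · simp only [if_neg he]
        exact .of_continuousAt hb hp fun x => hc (x, e) he
    · simpa only [if_pos (intCast_mem_ESet _),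
        fun k : ℤ => (hl k (intCast_mem_ESet k)).upper_eq] using ht
  · rintro ⟨G, ⟨hb, hp, hl⟩, hG, ht⟩
    exact ⟨hb, hp, fun p hp => (hl p.2).continuousAt (hG p hp), fun e x => f (x, e),
      fun e x => G (x, e), fun e _ => hl e, ht⟩

theorem intCast_eq_add_two_pi_mul {k j m : ℤ} (h : (k : ℝ) = j + 2 * Real.pi * m) : k = j := by
  rcases eq_or_ne m 0 with rfl | hm
  · simpa using h
  · refine absurd ⟨((k - j : ℤ) : ℚ) / ((2 * m : ℤ) : ℚ), ?_⟩ irrational_pi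
    have : (m : ℝ) ≠ 0 := by exact_mod_cast hm
    push_cast
    rw [div_eq_iff (by simpa using this)]
    linarith

theorem intCast_mem_ESetN {N : ℕ} {k : ℤ} : (k : ℝ) ∈ ESetN N ↔ |k| ≤ N := by
  refine ⟨?_, fun h => ⟨k, 0, h, by simp⟩⟩
  rintro ⟨j, m, hj, h⟩
  rwa [intCast_eq_add_two_pi_mul h]

theorem ESetN_subset_ESet (N : ℕ) : ESetN N ⊆ ESet := by
  rintro x ⟨k, m, -, h⟩
  exact ⟨k, m, h⟩

/-- The right-continuous `2π`-periodic sawtooth with jump `1` at the multiples of `2π`. -/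
def sawtooth (y : ℝ) : ℝ := ⌊y / (2 * Real.pi)⌋ - y / (2 * Real.pi)

/-- The limits from below of `sawtooth`. -/
def sawtoothLower (y : ℝ) : ℝ := ((⌈y / (2 * Real.pi)⌉ - 1 : ℤ) : ℝ) - y / (2 * Real.pi)

theorem sawtooth_add_two_pi (y : ℝ) : sawtooth (y + 2 * Real.pi) = sawtooth y := by
  have : (y + 2 * Real.pi) / (2 * Real.pi) = y / (2 * Real.pi) + 1 := by
    field_simp
  simp only [sawtooth, this, Int.floor_add_one]
  push_cast
  ring

theorem abs_sawtooth_le (y : ℝ) : |sawtooth y| ≤ 1 := by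
  rw [sawtooth, abs_le]
  constructor <;>
    linarith [Int.floor_le (y / (2 * Real.pi)), Int.lt_floor_add_one (y / (2 * Real.pi))]

theorem sawtooth_sub_sawtoothLower_two_pi_mul (m : ℤ) :
    sawtooth (2 * Real.pi * m) - sawtoothLower (2 * Real.pi * m) = 1 := by
  have : 2 * Real.pi * m / (2 * Real.pi) = m := by field_simp
  simp [sawtooth, sawtoothLower, this]

theorem sawtooth_eq_sawtoothLower {y : ℝ} (h : ∀ m : ℤ, y ≠ 2 * Real.pi * m) :
    sawtooth y = sawtoothLower y := by
  have h' : y / (2 * Real.pi) ∉ Set.range ((↑) : ℤ → ℝ) := by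
    rintro ⟨m, hm⟩
    apply h m
    rw [hm]
    field_simp
  simp [sawtooth, sawtoothLower, (Int.ceil_eq_floor_add_one_iff_notMem _).2 h']

theorem continuousWithinAt_sawtooth (y : ℝ) : Tendsto sawtooth (𝓝[≥] y) (𝓝 (sawtooth y)) := by
  have hd : Tendsto (fun y : ℝ => y / (2 * Real.pi)) (𝓝[≥] y) (𝓝[≥] (y / (2 * Real.pi))) := by
    refine tendsto_nhdsWithin_iff.2 ⟨Tendsto.mono_left (Continuous.tendsto (by fun_prop) y)
      nhdsWithin_le_nhds, ?_⟩
    filter_upwards [self_mem_nhdsWithin] with z hz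
    exact div_le_div_of_nonneg_right hz Real.two_pi_pos.le
  have hf : Tendsto (fun y : ℝ => ((⌊y / (2 * Real.pi)⌋ : ℤ) : ℝ)) (𝓝[≥] y)
      (𝓝 (⌊y / (2 * Real.pi)⌋ : ℝ)) :=
    ((tendsto_pure_pure (Int.cast : ℤ → ℝ) _).comp
      ((tendsto_floor_right_pure_floor _).comp hd)).mono_right (pure_le_nhds _)
  exact hf.sub (hd.mono_right nhdsWithin_le_nhds)

theorem tendsto_sawtooth_below (y : ℝ) :
    Tendsto sawtooth (𝓝[<] y) (𝓝 (sawtoothLower y)) := by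
  have hd : Tendsto (fun y : ℝ => y / (2 * Real.pi)) (𝓝[<] y) (𝓝[<] (y / (2 * Real.pi))) := by
    refine tendsto_nhdsWithin_iff.2 ⟨Tendsto.mono_left (Continuous.tendsto (by fun_prop) y)
      nhdsWithin_le_nhds, ?_⟩
    filter_upwards [self_mem_nhdsWithin] with z hz
    exact div_lt_div_of_pos_right hz Real.two_pi_pos
  have hf : Tendsto (fun y : ℝ => ((⌊y / (2 * Real.pi)⌋ : ℤ) : ℝ)) (𝓝[<] y)
      (𝓝 ((⌈y / (2 * Real.pi)⌉ - 1 : ℤ) : ℝ)) :=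
    ((tendsto_pure_pure (Int.cast : ℤ → ℝ) _).comp
      ((tendsto_floor_left_pure_ceil_sub_one _).comp hd)).mono_right (pure_le_nhds _)
  exact hf.sub (hd.mono_right nhdsWithin_le_nhds)

theorem hasLowerLimits_mul_sawtooth {a : ℝ → ℂ} (ha : NicePer a) (c : ℝ) :
    HasLowerLimits (fun p => a p.1 * (sawtooth (p.2 - c) : ℂ))
      (fun p => a p.1 * (sawtoothLower (p.2 - c) : ℂ)) := by
  refine ⟨?_, fun x y => ⟨?_, ?_⟩, fun e => ⟨ha.mul_const (sawtooth (e - c)),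
    ha.mul_const (sawtoothLower (e - c)), fun x =>
    ⟨?_, ?_, rfl⟩⟩⟩
  · obtain ⟨⟨C, hC⟩, -⟩ := ha
    refine ⟨C, fun p => ?_⟩
    rw [norm_mul, Complex.norm_real, Real.norm_eq_abs]
    calc _ ≤ C * 1 := mul_le_mul (hC _) (abs_sawtooth_le _) (abs_nonneg _)
          ((norm_nonneg _).trans (hC p.1))
      _ = C := mul_one C
  · simp only [ha.2.2]
  · simp only [add_sub_right_comm y, sawtooth_add_two_pi]
  all_goals
    refine ((ha.2.1.comp continuous_fst).tendsto' (x, e) _ rfl |>.mono_left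
      nhdsWithin_le_nhds).mul ((Complex.continuous_ofReal.tendsto _).comp ?_)
  · refine (continuousWithinAt_sawtooth (e - c)).comp
      (Tendsto.comp (g := fun t : ℝ => t - c) ?_ (tendsto_snd_above x e))
    refine tendsto_nhdsWithin_iff.2 ⟨Tendsto.mono_left (Continuous.tendsto (by fun_prop) e)
      nhdsWithin_le_nhds, ?_⟩
    filter_upwards [self_mem_nhdsWithin] with z hz
    exact sub_le_sub_right (Set.mem_Ici.1 hz) c
  · refine (tendsto_sawtooth_below (e - c)).comp
      (Tendsto.comp (g := fun t : ℝ => t - c) ?_ (tendsto_snd_below x e))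
    refine tendsto_nhdsWithin_iff.2 ⟨Tendsto.mono_left (Continuous.tendsto (by fun_prop) e)
      nhdsWithin_le_nhds, ?_⟩
    filter_upwards [self_mem_nhdsWithin] with z hz
    exact sub_lt_sub_right (Set.mem_Iio.1 hz) c

theorem Per.exists_lift {h : ℝ × ℝ → ℂ} (hp : Per h) :
    ∃ H : AddCircle (2 * Real.pi) × AddCircle (2 * Real.pi) → ℂ,
      ∀ x y : ℝ, H (x, y) = h (x, y) := by
  have h2 : ∀ x, Function.Periodic (fun y => h (x, y)) (2 * Real.pi) := fun x y => (hp x y).2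
  have h1 : Function.Periodic (fun x => (h2 x).lift) (2 * Real.pi) := fun x => by
    funext b
    induction b using QuotientAddGroup.induction_on with
    | H y => exact (hp x y).1
  exact ⟨fun p => h1.lift p.1 p.2, fun x y => rfl⟩

theorem nhds_addCircle_prod (x y : ℝ) :
    𝓝 ((x : AddCircle (2 * Real.pi)), (y : AddCircle (2 * Real.pi))) =
      map (fun p : ℝ × ℝ => ((p.1 : AddCircle (2 * Real.pi)), (p.2 : AddCircle (2 * Real.pi))))
        (𝓝 (x, y)) := by
  rw [nhds_prod_eq, nhds_prod_eq, QuotientAddGroup.nhds_eq, QuotientAddGroup.nhds_eq,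
    prod_map_map_eq]

/-- A periodic function with lower limits, whose jumps are small, is uniformly close to a
continuous periodic function. -/
theorem HasLowerLimits.exists_continuous {h H : ℝ × ℝ → ℂ} (hh : HasLowerLimits h H) {ε : ℝ}
    (hE : ∀ p : ℝ × ℝ, p.2 ∉ ESet → ‖h p - H p‖ < ε)
    (hZ : ∀ (x : ℝ) (k : ℤ), ‖h (x, k) - H (x, k)‖ < ε) :
    ∃ g : ℝ × ℝ → ℂ, Bdd g ∧ Per g ∧ Continuous g ∧ ∀ p, ‖h p - g p‖ ≤ ε := by
  have : Fact (0 < 2 * Real.pi) := ⟨Real.two_pi_pos⟩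
  obtain ⟨L, hL⟩ := hh.2.1.exists_lift
  have key : ∀ q : AddCircle (2 * Real.pi) × AddCircle (2 * Real.pi),
      ∃ c, ∀ᶠ r in 𝓝 q, c ∈ Metric.closedBall (L r) ε := by
    have aux : ∀ x y : ℝ, ‖h (x, y) - H (x, y)‖ < ε →
        ∃ c, ∀ᶠ r in 𝓝 ((x : AddCircle (2 * Real.pi)), (y : AddCircle (2 * Real.pi))),
          c ∈ Metric.closedBall (L r) ε := by
      intro x y hxy
      refine ⟨h (x, y), ?_⟩
      rw [nhds_addCircle_prod, eventually_map]
      filter_upwards [(hh.2.2 y).eventually_norm_sub_lt hxy] with r hr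
      rw [hL, Metric.mem_closedBall, dist_eq_norm]
      exact hr.le
    rintro ⟨a, b⟩
    induction a using QuotientAddGroup.induction_on with
    | H x =>
    induction b using QuotientAddGroup.induction_on with
    | H y =>
    by_cases hy : y ∈ ESet
    · obtain ⟨k, m, rfl⟩ := hy
      have hk : ((k + 2 * Real.pi * m : ℝ) : AddCircle (2 * Real.pi)) = (k : ℝ) := by
        rw [AddCircle.coe_add, mul_comm _ (m : ℝ), ← zsmul_eq_mul, AddCircle.coe_zsmul,
          AddCircle.coe_period, smul_zero, add_zero]
      obtain ⟨c, hc⟩ := aux x k (hZ x k)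
      exact ⟨c, by rw [← hk] at hc; exact hc⟩
    · exact aux x y (hE (x, y) hy)
  obtain ⟨φ, hφ⟩ := exists_continuous_forall_mem_convex_of_local_const
    (fun q => convex_closedBall (L q) ε) key
  obtain ⟨C, hC⟩ := (isCompact_range φ.continuous).isBounded.exists_norm_le
  refine ⟨fun p => φ (p.1, p.2), ⟨C, fun p => hC _ (Set.mem_range_self _)⟩, fun x y => ?_, ?_,
    fun p => ?_⟩
  · simp only [AddCircle.coe_add_period, and_self]
  · exact φ.continuous.comp (((AddCircle.continuous_mk' _).comp continuous_fst).prodMk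
      ((AddCircle.continuous_mk' _).comp continuous_snd))
  · have := hφ (p.1, p.2)
    rw [hL, Metric.mem_closedBall, dist_comm, dist_eq_norm] at this
    exact this

theorem MemA.exists_memC {f : ℝ × ℝ → ℂ} (hf : MemA f) {ε : ℝ} (hε : 0 < ε) :
    ∃ (N : ℕ) (g : ℝ × ℝ → ℂ), MemC N g ∧ ∀ p : ℝ × ℝ, ‖f p - g p‖ ≤ ε := by
  obtain ⟨G, hG, hE, ht⟩ := memA_iff.1 hf
  have ha : ∀ e : ℝ, NicePer (fun x => f (x, e) - G (x, e)) := fun e =>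
    (hG.2.2 e).1.sub (hG.2.2 e).2.1
  have hsmall : {k : ℤ | ¬ (⨆ x : ℝ, ‖f (x, k) - G (x, k)‖) < ε}.Finite :=
    ht.eventually_lt_const hε
  obtain ⟨N, hN⟩ : ∃ N : ℕ, ∀ k : ℤ, ¬ |k| ≤ N → ∀ x : ℝ, ‖f (x, k) - G (x, k)‖ < ε := by
    obtain ⟨N, hN⟩ := (hsmall.image Int.natAbs).bddAbove
    refine ⟨N, fun k hk x => lt_of_le_of_lt (b := ⨆ x : ℝ, ‖f (x, k) - G (x, k)‖) ?_
      (not_not.1 fun hk' => hk ?_)⟩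
    · obtain ⟨C, hC⟩ := (ha k).1
      exact le_ciSup (f := fun x : ℝ => ‖f (x, k) - G (x, k)‖)
        ⟨C, Set.forall_mem_range.2 hC⟩ x
    · rw [Int.abs_eq_natAbs]
      exact_mod_cast hN (Set.mem_image_of_mem Int.natAbs hk')
  set s : Finset ℤ := Finset.Icc (-N : ℤ) N with hs
  have hmem : ∀ k : ℤ, k ∈ s ↔ |k| ≤ N := fun k => by rw [hs, Finset.mem_Icc, abs_le]
  have hT := HasLowerLimits.sum s fun j _ => hasLowerLimits_mul_sawtooth (ha j) (j : ℝ)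
  set T : ℝ × ℝ → ℂ := fun p => ∑ j ∈ s, (f (p.1, j) - G (p.1, j)) * (sawtooth (p.2 - j) : ℂ)
  set U : ℝ × ℝ → ℂ :=
    fun p => ∑ j ∈ s, (f (p.1, j) - G (p.1, j)) * (sawtoothLower (p.2 - j) : ℂ)
  have hTU : ∀ p : ℝ × ℝ, p.2 ∉ ESetN N → T p = U p := by
    intro p hp
    refine Finset.sum_congr rfl fun j hj => ?_
    rw [sawtooth_eq_sawtoothLower]
    intro m hm
    exact hp ⟨j, m, (hmem j).1 hj, by linarith⟩
  have hTUk : ∀ (x : ℝ) (k : ℤ), |k| ≤ N → T (x, k) - U (x, k) = f (x, k) - G (x, k) := by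
    intro x k hk
    simp only [T, U]
    rw [← Finset.sum_sub_distrib, Finset.sum_eq_single_of_mem k ((hmem k).2 hk)]
    · have := sawtooth_sub_sawtoothLower_two_pi_mul 0
      simp only [Int.cast_zero, mul_zero] at this
      rw [sub_self, ← mul_sub, ← Complex.ofReal_sub, this, Complex.ofReal_one, mul_one]
    · intro j _ hjk
      rw [sawtooth_eq_sawtoothLower, sub_self]
      intro m hm
      exact hjk (intCast_eq_add_two_pi_mul (m := m) (k := k) (by linarith)).symm
  obtain ⟨g, hgb, hgp, hgc, hg⟩ := (hG.sub hT).exists_continuous (ε := ε)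
    (fun p hp => by
      rw [hE p hp, hTU p fun h => hp (ESetN_subset_ESet N h), sub_self, norm_zero]
      exact hε)
    (fun x k => by
      rw [sub_sub_sub_comm]
      by_cases hk : |k| ≤ N
      · rw [hTUk x k hk, sub_self, norm_zero]
        exact hε
      · rw [hTU (x, k) (fun h => hk (intCast_mem_ESetN.1 h)), sub_self, sub_zero]
        exact hN k hk x)
  refine ⟨N, fun p => g p + T p, memC_iff.2 ⟨_, (HasLowerLimits.of_continuous hgb hgp hgc).add hT,
    fun p hp => by rw [hTU p hp]⟩, fun p => ?_⟩
  change ‖f p - (g p + T p)‖ ≤ ε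
  rw [sub_add_eq_sub_sub_swap]
  exact hg p

theorem memA_of_approx {f : ℝ × ℝ → ℂ} (hb : Bdd f) (hp : Per f)
    (h : ∀ ε : ℝ, 0 < ε →
      ∃ (N : ℕ) (g : ℝ × ℝ → ℂ), MemC N g ∧ ∀ p : ℝ × ℝ, ‖f p - g p‖ ≤ ε) : MemA f := by
  have hex : ∀ e, ∃ fm, SidedLimits f e (fun x => f (x, e)) fm := fun e =>
    SidedLimits.exists_of_approx fun ε hε => by
      obtain ⟨N, g, hg, hfg⟩ := h ε hε
      obtain ⟨G, hG, -⟩ := memC_iff.1 hg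
      exact ⟨g, _, _, hG.2.2 e, hfg⟩
  choose fm hfm using hex
  have hjump : ∀ ε : ℝ, 0 < ε → ∃ N : ℕ, ∀ e ∉ ESetN N, ∀ x, ‖f (x, e) - fm e x‖ ≤ 2 * ε := by
    intro ε hε
    obtain ⟨N, g, hg, hfg⟩ := h ε hε
    obtain ⟨G, hG, hGN⟩ := memC_iff.1 hg
    refine ⟨N, fun e he x => (hfm e).norm_jump_le (g := g) (gp := fun x => g (x, e)) ?_ hfg x⟩
    have := hG.2.2 e
    rwa [← funext fun x => hGN (x, e) he] at this
  refine memA_iff.2 ⟨fun p => fm p.2 p.1, ⟨hb, hp, hfm⟩, fun p hp => ?_, ?_⟩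
  · refine norm_sub_le_of_forall_pos fun ε hε => ?_
    obtain ⟨N, hN⟩ := hjump ε hε
    exact hN p.2 (fun h => hp (ESetN_subset_ESet N h)) p.1
  · rw [Metric.tendsto_nhds]
    intro ε hε
    obtain ⟨N, hN⟩ := hjump (ε / 4) (by positivity)
    refine ((Finset.Icc (-N : ℤ) N).finite_toSet).subset fun k hk => ?_
    by_contra hkN
    refine hk ?_
    have hle : ⨆ x : ℝ, ‖f (x, k) - fm k x‖ ≤ 2 * (ε / 4) := ciSup_le fun x =>
      hN k (fun h => hkN (by
        rw [Finset.coe_Icc, Set.mem_Icc, ← abs_le]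
        exact intCast_mem_ESetN.1 h)) x
    have hnn : 0 ≤ ⨆ x : ℝ, ‖f (x, k) - fm k x‖ := Real.iSup_nonneg fun _ => norm_nonneg _
    simp only [Set.mem_ofPred_eq, Real.dist_eq, sub_zero, abs_of_nonneg hnn]
    linarith

/-- The closure of `⋃_N 𝒞_N` in the sup norm, taken inside the space of bounded
functions on `ℝ²` that are `2π`-periodic in each variable, is exactly `𝒜`: a bounded
`2π`-periodic function `f` belongs to `𝒜` iff it can be approximated in the sup norm,
to within any `ε > 0`, by some `g ∈ 𝒞_N`. -/
theorem stmt_3 :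
    ∀ f : ℝ × ℝ → ℂ, Bdd f → Per f →
      (MemA f ↔ ∀ ε : ℝ, 0 < ε →
        ∃ (N : ℕ) (g : ℝ × ℝ → ℂ), MemC N g ∧ ∀ p : ℝ × ℝ, ‖f p - g p‖ ≤ ε) :=
  fun _ hb hp => ⟨fun hf _ hε => hf.exists_memC hε, memA_of_approx hb hp⟩
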